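/- Consider the power network η̇ = Dᵀω, Mω̇ = u − DΓ(V)sin(η) − Aω − P^l, TV̇ = −E(η)V + Ē_fd with constant demand P^l, controlled by the distributed controllers θ̇ = −L_comm·θ − Q⁻¹ω, u = Q⁻¹θ, where L_comm is the Laplacian of a connected undirected communication graph and Q is diagonal positive definite. Suppose there exist η̄ ∈ range(Dᵀ), V̄ ∈ ℝⁿ with positive entries satisfying (Q⁻¹1ₙ1ₙᵀ/(1ₙᵀQ⁻¹1ₙ) − I)P^l = DΓ(V̄)sin(η̄) and E(η̄)V̄ = Ē_fd, and that η̄ ∈ (−π/2, π/2)^m and E(η̄) − diag(V̄)⁻¹|D|Γ(V̄)diag(sin(η̄))diag(cos(η̄))⁻¹diag(sin(η̄))|D|ᵀdiag(V̄)⁻¹ is positive definite. Set θ̄ = (1ₙ1ₙᵀP^l)/(1ₙᵀQ⁻¹1ₙ) and ū = Q⁻¹θ̄. Then there is a neighborhood of (η̄, 0, V̄, θ̄) such that every solution of the closed-loop system starting in it is bounded and satisfies, as t → ∞: ω(t) → 0, θ(t) → θ̄, u(t) → ū, and E(η(t))V(t) − Ē_fd → 0; the limit input ū minimizes the generation cost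 C(u) = ½uᵀQu subject to 1ₙᵀ(u − P^l) = 0. -/

import Mathlib

open Matrix Real Filter Topology Set

noncomputable section

/-- `Vec n` is `ℝⁿ`. -/
abbrev Vec (n : ℕ) := Fin n → ℝ

/-- Incidence matrix of the (undirected, arbitrarily oriented) graph whose `m` edges have
endpoints `ep1 k` (positive end) and `ep2 k` (negative end). -/
def incD {n m : ℕ} (ep1 ep2 : Fin m → Fin n) : Matrix (Fin n) (Fin m) ℝ :=
  Matrix.of fun i k => if i = ep1 k then 1 else if i = ep2 k then -1 else 0

/-- `Γ(V) = diag(γ₁,…,γ_m)`, `γ_k = V_i V_j B_{ij}` for edge `k = {i,j}`. -/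
def Gam {n m : ℕ} (ep1 ep2 : Fin m → Fin n) (B : Fin m → ℝ) (V : Vec n) :
    Matrix (Fin m) (Fin m) ℝ :=
  Matrix.diagonal fun k => V (ep1 k) * V (ep2 k) * B k

/-- The matrix `E(η)`. -/
def Emat {n m : ℕ} (ep1 ep2 : Fin m → Fin n) (B : Fin m → ℝ)
    (Bii Xd Xd' : Vec n) (η : Vec m) : Matrix (Fin n) (Fin n) ℝ :=
  Matrix.of fun i j =>
    if i = j then (1 - Bii i * (Xd i - Xd' i)) / (Xd i - Xd' i)
    else -∑ k, (if (ep1 k = i ∧ ep2 k = j) ∨ (ep1 k = j ∧ ep2 k = i)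
      then B k * Real.cos (η k) else 0)

/-- The diagonal matrix `F`. -/
def Fmat {n : ℕ} (Bii Xd Xd' : Vec n) : Matrix (Fin n) (Fin n) ℝ :=
  Matrix.diagonal fun i => (1 - Bii i * (Xd i - Xd' i)) / (Xd i - Xd' i)

/-- componentwise sine -/
def sinv {m : ℕ} (η : Vec m) : Vec m := fun k => Real.sin (η k)
/-- componentwise cosine -/
def cosv {m : ℕ} (η : Vec m) : Vec m := fun k => Real.cos (η k)

/-- The storage function `W₂` with reference point `(ηb, Vb)`. -/
def W2 {n m : ℕ} (ep1 ep2 : Fin m → Fin n) (B : Fin m → ℝ) (Bii Xd Xd' : Vec n)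
    (Efd : Vec n) (ηb : Vec m) (Vb : Vec n) (η : Vec m) (V : Vec n) : ℝ :=
  -((1 : Vec m) ⬝ᵥ (Gam ep1 ep2 B V).mulVec (cosv η))
    + (1 : Vec m) ⬝ᵥ (Gam ep1 ep2 B Vb).mulVec (cosv ηb)
    - ((Gam ep1 ep2 B Vb).mulVec (sinv ηb)) ⬝ᵥ (η - ηb)
    - Efd ⬝ᵥ (V - Vb)
    + (1 / 2) * (V ⬝ᵥ (Fmat Bii Xd Xd').mulVec V)
    - (1 / 2) * (Vb ⬝ᵥ (Fmat Bii Xd Xd').mulVec Vb)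

/-- entrywise absolute value `|D|` of the incidence matrix. -/
def absD {n m : ℕ} (ep1 ep2 : Fin m → Fin n) : Matrix (Fin n) (Fin m) ℝ :=
  Matrix.of fun i k => |incD ep1 ep2 i k|

/-- The matrix `E(η̄) − diag(V̄)⁻¹|D|Γ(V̄)diag(sin η̄)diag(cos η̄)⁻¹diag(sin η̄)|D|ᵀdiag(V̄)⁻¹`
appearing in Assumption 3. -/
def Schur {n m : ℕ} (ep1 ep2 : Fin m → Fin n) (B : Fin m → ℝ) (Bii Xd Xd' : Vec n)
    (ηb : Vec m) (Vb : Vec n) : Matrix (Fin n) (Fin n) ℝ :=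
  Emat ep1 ep2 B Bii Xd Xd' ηb -
    (Matrix.diagonal fun i => (Vb i)⁻¹) * absD ep1 ep2 * Gam ep1 ep2 B Vb *
      Matrix.diagonal (sinv ηb) * (Matrix.diagonal (cosv ηb))⁻¹ *
      Matrix.diagonal (sinv ηb) * (absD ep1 ep2)ᵀ * (Matrix.diagonal fun i => (Vb i)⁻¹)


variable {n m : ℕ}

lemma incD_transpose_mulVec_apply {ep1 ep2 : Fin m → Fin n} (hep : ∀ k, ep1 k ≠ ep2 k)
    (x : Vec n) (k : Fin m) :
    ((incD ep1 ep2)ᵀ.mulVec x) k = x (ep1 k) - x (ep2 k) := by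
  have h : ∀ i, (if i = ep1 k then (1 : ℝ) else if i = ep2 k then -1 else 0)
      = (if i = ep1 k then 1 else 0) - (if i = ep2 k then 1 else 0) := fun i => by
    have := hep k
    grind
  simp [Matrix.mulVec, dotProduct, incD, h, sub_mul, Finset.sum_sub_distrib]

lemma absD_transpose_mulVec_apply {ep1 ep2 : Fin m → Fin n} (hep : ∀ k, ep1 k ≠ ep2 k)
    (x : Vec n) (k : Fin m) :
    ((absD ep1 ep2)ᵀ.mulVec x) k = x (ep1 k) + x (ep2 k) := by
  have h : ∀ i, |if i = ep1 k then (1 : ℝ) else if i = ep2 k then -1 else 0|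
      = (if i = ep1 k then 1 else 0) + (if i = ep2 k then 1 else 0) := fun i => by
    have := hep k
    split_ifs <;> grind
  simp [Matrix.mulVec, dotProduct, absD, incD, h, add_mul, Finset.sum_add_distrib]

lemma sum_incD_mulVec {ep1 ep2 : Fin m → Fin n} (hep : ∀ k, ep1 k ≠ ep2 k) (y : Vec m) :
    ∑ i, ((incD ep1 ep2).mulVec y) i = 0 := by
  have h : (incD ep1 ep2)ᵀ.mulVec (1 : Vec n) = 0 := by
    ext k
    simp [incD_transpose_mulVec_apply hep]
  rw [← one_dotProduct, Matrix.dotProduct_mulVec, ← Matrix.mulVec_transpose, h, zero_dotProduct]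

lemma dotProduct_Emat_mulVec {ep1 ep2 : Fin m → Fin n} (hep : ∀ k, ep1 k ≠ ep2 k)
    (B : Fin m → ℝ) (Bii Xd Xd' : Vec n) (η : Vec m) (v V : Vec n) :
    v ⬝ᵥ (Emat ep1 ep2 B Bii Xd Xd' η).mulVec V
      = v ⬝ᵥ (Fmat Bii Xd Xd').mulVec V
        - ∑ k, B k * cos (η k) * (v (ep1 k) * V (ep2 k) + v (ep2 k) * V (ep1 k)) := by
  have hE : ∀ i j, Emat ep1 ep2 B Bii Xd Xd' η i j = Fmat Bii Xd Xd' i j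
      - ∑ k, B k * cos (η k) * ((if i = ep1 k then 1 else 0) * (if j = ep2 k then 1 else 0)
        + (if i = ep2 k then 1 else 0) * (if j = ep1 k then 1 else 0)) := by
    intro i j
    by_cases hij : i = j
    · subst hij
      have : ∀ k, B k * cos (η k) * ((if i = ep1 k then 1 else 0) * (if i = ep2 k then 1 else 0)
        + (if i = ep2 k then 1 else 0) * (if i = ep1 k then 1 else 0)) = 0 := fun k => by
        have := hep k
        grind
      rw [Finset.sum_congr rfl fun k _ => this k]
      simp [Emat, Fmat]
    · simp only [Emat, Matrix.of_apply, hij, if_false, Fmat, ne_eq, not_false_eq_true,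
        Matrix.diagonal_apply_ne, zero_sub, neg_inj]
      refine Finset.sum_congr rfl fun k _ => ?_
      have := hep k
      grind
  simp only [Matrix.mulVec, dotProduct, hE, sub_mul, Finset.sum_sub_distrib, mul_sub]
  congr 1
  simp only [Finset.sum_mul, Finset.mul_sum]
  rw [Finset.sum_congr rfl fun i _ => Finset.sum_comm, Finset.sum_comm]
  refine Finset.sum_congr rfl fun k _ => ?_
  have : ∀ i j, v i * (B k * cos (η k) * ((if i = ep1 k then 1 else 0) *
      (if j = ep2 k then 1 else 0) + (if i = ep2 k then 1 else 0) *
      (if j = ep1 k then 1 else 0)) * V j)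
    = B k * cos (η k) * ((if i = ep1 k then v i else 0) * (if j = ep2 k then V j else 0)
      + (if i = ep2 k then v i else 0) * (if j = ep1 k then V j else 0)) := by
    intro i j
    split_ifs <;> ring
  simp only [this, ← Finset.mul_sum, Finset.sum_add_distrib, ← Finset.sum_mul]
  simp

lemma dotProduct_Schur_mulVec {ep1 ep2 : Fin m → Fin n} (hep : ∀ k, ep1 k ≠ ep2 k)
    (B : Fin m → ℝ) (Bii Xd Xd' : Vec n) {η : Vec m} (hη : ∀ k, cos (η k) ≠ 0) (V v : Vec n) :
    v ⬝ᵥ (Schur ep1 ep2 B Bii Xd Xd' η V).mulVec v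
      = v ⬝ᵥ (Emat ep1 ep2 B Bii Xd Xd' η).mulVec v
        - ∑ k, V (ep1 k) * V (ep2 k) * B k * (sin (η k) ^ 2 / cos (η k))
          * (v (ep1 k) / V (ep1 k) + v (ep2 k) / V (ep2 k)) ^ 2 := by
  have hinv : (Matrix.diagonal (cosv η))⁻¹ = Matrix.diagonal fun k => (cos (η k))⁻¹ := by
    refine Matrix.inv_eq_right_inv ?_
    rw [Matrix.diagonal_mul_diagonal, ← Matrix.diagonal_one]
    congr 1
    ext k
    exact mul_inv_cancel₀ (hη k)
  set R : Matrix (Fin n) (Fin n) ℝ := Matrix.diagonal fun i => (V i)⁻¹ with hR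
  have hp : ∀ k, ((absD ep1 ep2)ᵀ.mulVec (R.mulVec v)) k
      = v (ep1 k) / V (ep1 k) + v (ep2 k) / V (ep2 k) := fun k => by
    rw [absD_transpose_mulVec_apply hep]
    simp [hR, Matrix.mulVec_diagonal, div_eq_inv_mul]
  rw [Schur, Matrix.sub_mulVec, dotProduct_sub, hinv]
  congr 1
  simp only [← Matrix.mulVec_mulVec, Gam]
  rw [← hR, Matrix.dotProduct_mulVec, ← Matrix.mulVec_transpose, Matrix.dotProduct_mulVec,
    ← Matrix.mulVec_transpose, hR, Matrix.diagonal_transpose, ← hR]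
  refine Finset.sum_congr rfl fun k _ => ?_
  simp only [Matrix.mulVec_diagonal, hp, sinv]
  ring

lemma W2_eq_sum (ep1 ep2 : Fin m → Fin n) (B : Fin m → ℝ) (Bii Xd Xd' Efd : Vec n)
    (ηb : Vec m) (Vb : Vec n) (η : Vec m) (V : Vec n) :
    W2 ep1 ep2 B Bii Xd Xd' Efd ηb Vb η V
      = ∑ k, (V (ep1 k) * V (ep2 k) * B k * -cos (η k)
          + Vb (ep1 k) * Vb (ep2 k) * B k * cos (ηb k)
          - Vb (ep1 k) * Vb (ep2 k) * B k * sin (ηb k) * (η k - ηb k))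
        + ∑ i, (1 / 2 * (Fmat Bii Xd Xd' i i * V i ^ 2) - Efd i * (V i - Vb i)
          - 1 / 2 * (Fmat Bii Xd Xd' i i * Vb i ^ 2)) := by
  simp only [W2, Gam, Fmat, dotProduct, Matrix.mulVec_diagonal, cosv, sinv, Pi.one_apply, one_mul,
    Pi.sub_apply, Matrix.diagonal_apply_eq, Finset.sum_add_distrib, Finset.sum_sub_distrib,
    Finset.mul_sum, mul_neg, Finset.sum_neg_distrib]
  have h : ∀ (f U : Vec n), ∑ i, 1 / 2 * (U i * (f i * U i)) = ∑ i, 1 / 2 * (f i * U i ^ 2) :=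
    fun f U => Finset.sum_congr rfl fun i _ => by ring
  rw [h, h]
  ring

lemma hasDerivAt_W2 {ep1 ep2 : Fin m → Fin n} (hep : ∀ k, ep1 k ≠ ep2 k)
    (B : Fin m → ℝ) (Bii Xd Xd' Efd : Vec n) (ηb : Vec m) (Vb : Vec n)
    {η : ℝ → Vec m} {V : ℝ → Vec n} {a : Vec m} {v : Vec n} {t : ℝ}
    (hη : HasDerivAt η a t) (hV : HasDerivAt V v t) :
    HasDerivAt (fun s => W2 ep1 ep2 B Bii Xd Xd' Efd ηb Vb (η s) (V s))
      (((Gam ep1 ep2 B (V t)).mulVec (sinv (η t)) - (Gam ep1 ep2 B Vb).mulVec (sinv ηb)) ⬝ᵥ a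
        + v ⬝ᵥ ((Emat ep1 ep2 B Bii Xd Xd' (η t)).mulVec (V t) - Efd)) t := by
  have h1 := hasDerivAt_pi.1 hη
  have h2 := hasDerivAt_pi.1 hV
  simp only [W2_eq_sum]
  refine ((HasDerivAt.fun_sum fun k _ =>
    (((((h2 (ep1 k)).fun_mul (h2 (ep2 k))).mul_const (B k)).fun_mul (h1 k).cos.fun_neg).add_const
      (Vb (ep1 k) * Vb (ep2 k) * B k * cos (ηb k))).fun_sub
      (((h1 k).sub_const (ηb k)).const_mul (Vb (ep1 k) * Vb (ep2 k) * B k * sin (ηb k)))).fun_add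
    (HasDerivAt.fun_sum fun i _ =>
    ((((((h2 i).fun_pow 2).const_mul (Fmat Bii Xd Xd' i i)).const_mul (1 / 2))).fun_sub
      (((h2 i).sub_const (Vb i)).const_mul (Efd i))).sub_const
        (1 / 2 * (Fmat Bii Xd Xd' i i * Vb i ^ 2)))).congr_deriv ?_
  rw [dotProduct_sub, dotProduct_Emat_mulVec hep]
  simp only [dotProduct, Gam, Fmat, Matrix.mulVec_diagonal, sinv, Pi.sub_apply,
    Matrix.diagonal_apply_eq]
  rw [show ∀ p f c e : ℝ, p + (f - c - e) = (p - c) + (f - e) from fun _ _ _ _ => by ring,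
    ← Finset.sum_sub_distrib, ← Finset.sum_sub_distrib]
  congr 1
  · exact Finset.sum_congr rfl fun k _ => by ring
  · exact Finset.sum_congr rfl fun i _ => by push_cast; ring

/-- The Hessian of `W2` at `(η, V)`, as a quadratic form in the direction `(a, v)`. -/
def W2Hess (ep1 ep2 : Fin m → Fin n) (B : Fin m → ℝ) (Bii Xd Xd' : Vec n)
    (η : Vec m) (V : Vec n) (a : Vec m) (v : Vec n) : ℝ :=
  ∑ k, (V (ep1 k) * V (ep2 k) * B k * cos (η k) * a k ^ 2
      + 2 * (B k * sin (η k) * a k * (v (ep1 k) * V (ep2 k) + v (ep2 k) * V (ep1 k))))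
    + v ⬝ᵥ (Emat ep1 ep2 B Bii Xd Xd' η).mulVec v

lemma hasDerivAt_W2_gradient {ep1 ep2 : Fin m → Fin n} (hep : ∀ k, ep1 k ≠ ep2 k)
    (B : Fin m → ℝ) (Bii Xd Xd' Efd : Vec n) (c : Vec m)
    {η : ℝ → Vec m} {V : ℝ → Vec n} {a : Vec m} {v : Vec n} {t : ℝ}
    (hη : HasDerivAt η a t) (hV : HasDerivAt V v t) :
    HasDerivAt (fun s => ((Gam ep1 ep2 B (V s)).mulVec (sinv (η s)) - c) ⬝ᵥ a
        + v ⬝ᵥ ((Emat ep1 ep2 B Bii Xd Xd' (η s)).mulVec (V s) - Efd))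
      (W2Hess ep1 ep2 B Bii Xd Xd' (η t) (V t) a v) t := by
  have h1 := hasDerivAt_pi.1 hη
  have h2 := hasDerivAt_pi.1 hV
  simp only [W2Hess, dotProduct_sub, dotProduct_Emat_mulVec hep]
  simp only [dotProduct, Gam, Fmat, Matrix.mulVec_diagonal, sinv, Pi.sub_apply]
  refine ((HasDerivAt.fun_sum fun k _ =>
    (((((h2 (ep1 k)).fun_mul (h2 (ep2 k))).mul_const (B k)).fun_mul (h1 k).sin).sub_const
      (c k)).mul_const (a k)).fun_add
    (((HasDerivAt.fun_sum fun i _ => ((h2 i).const_mul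
      ((1 - Bii i * (Xd i - Xd' i)) / (Xd i - Xd' i))).const_mul (v i)).fun_sub
    (HasDerivAt.fun_sum fun k _ => ((h1 k).cos.const_mul (B k)).fun_mul
      (((h2 (ep2 k)).const_mul (v (ep1 k))).fun_add
        ((h2 (ep1 k)).const_mul (v (ep2 k)))))).sub_const (∑ i, v i * Efd i))).congr_deriv ?_
  rw [show ∀ p f c : ℝ, p + (f - c) = (p - c) + f from fun _ _ _ => by ring,
    show ∀ p f c : ℝ, p + (f - c) = (p - c) + f from fun _ _ _ => by ring,
    ← Finset.sum_sub_distrib, ← Finset.sum_sub_distrib]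
  congr 1
  exact Finset.sum_congr rfl fun k _ => by ring

lemma W2Hess_smul (ep1 ep2 : Fin m → Fin n) (B : Fin m → ℝ) (Bii Xd Xd' : Vec n)
    (η : Vec m) (V : Vec n) (a : Vec m) (v : Vec n) (r : ℝ) :
    W2Hess ep1 ep2 B Bii Xd Xd' η V (r • a) (r • v)
      = r ^ 2 * W2Hess ep1 ep2 B Bii Xd Xd' η V a v := by
  simp only [W2Hess, Matrix.mulVec_smul, smul_dotProduct, dotProduct_smul, Pi.smul_apply,
    smul_eq_mul, mul_add, Finset.mul_sum]
  congr 1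
  · exact Finset.sum_congr rfl fun k _ => by ring
  · ring

lemma continuous_Emat (ep1 ep2 : Fin m → Fin n) (B : Fin m → ℝ) (Bii Xd Xd' : Vec n) :
    Continuous (Emat ep1 ep2 B Bii Xd Xd') := by
  refine continuous_matrix fun i j => ?_
  simp only [Emat, Matrix.of_apply]
  split_ifs
  · fun_prop
  · refine (continuous_finsetSum _ fun k _ => ?_).neg
    split_ifs <;> fun_prop

lemma continuous_Gam (ep1 ep2 : Fin m → Fin n) (B : Fin m → ℝ) :
    Continuous (Gam ep1 ep2 B) :=
  Continuous.matrix_diagonal (by fun_prop)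

@[fun_prop]
lemma continuous_sinv : Continuous (sinv : Vec m → Vec m) := by
  unfold sinv
  fun_prop

lemma continuous_W2Hess (ep1 ep2 : Fin m → Fin n) (B : Fin m → ℝ) (Bii Xd Xd' : Vec n) :
    Continuous fun p : (Vec m × Vec n) × Vec m × Vec n =>
      W2Hess ep1 ep2 B Bii Xd Xd' p.1.1 p.1.2 p.2.1 p.2.2 := by
  have := continuous_Emat ep1 ep2 B Bii Xd Xd'
  unfold W2Hess
  refine Continuous.add (by fun_prop) (Continuous.dotProduct (by fun_prop) ?_)
  exact Continuous.matrix_mulVec (by fun_prop) (by fun_prop)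

lemma continuous_W2 (ep1 ep2 : Fin m → Fin n) (B : Fin m → ℝ) (Bii Xd Xd' Efd : Vec n)
    (ηb : Vec m) (Vb : Vec n) :
    Continuous fun p : Vec m × Vec n => W2 ep1 ep2 B Bii Xd Xd' Efd ηb Vb p.1 p.2 := by
  simp only [W2_eq_sum]
  fun_prop

/-- Completing the square in the angle variables: the Hessian is positive definite as soon as the
Schur complement of its angle block is. -/
lemma W2Hess_pos {ep1 ep2 : Fin m → Fin n} (hep : ∀ k, ep1 k ≠ ep2 k)
    {B : Fin m → ℝ} (hB : ∀ k, 0 < B k) {Bii Xd Xd' : Vec n} {η : Vec m} {V : Vec n}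
    (hV : ∀ i, 0 < V i) (hη : ∀ k, 0 < cos (η k))
    (hPD : (Schur ep1 ep2 B Bii Xd Xd' η V).PosDef) {a : Vec m} {v : Vec n}
    (hav : (a, v) ≠ 0) :
    0 < W2Hess ep1 ep2 B Bii Xd Xd' η V a v := by
  have key : W2Hess ep1 ep2 B Bii Xd Xd' η V a v
      = ∑ k, V (ep1 k) * V (ep2 k) * B k * cos (η k) * (a k + sin (η k) / cos (η k)
          * (v (ep1 k) / V (ep1 k) + v (ep2 k) / V (ep2 k))) ^ 2
        + v ⬝ᵥ (Schur ep1 ep2 B Bii Xd Xd' η V).mulVec v := by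
    rw [W2Hess, dotProduct_Schur_mulVec hep _ _ _ _ fun k => (hη k).ne', add_sub_left_comm,
      ← Finset.sum_sub_distrib, add_comm]
    congr 1
    refine Finset.sum_congr rfl fun k _ => ?_
    have h1 := (hη k).ne'
    have h2 := (hV (ep1 k)).ne'
    have h3 := (hV (ep2 k)).ne'
    field_simp
    ring
  have hc : ∀ k, 0 < V (ep1 k) * V (ep2 k) * B k * cos (η k) := fun k =>
    mul_pos (mul_pos (mul_pos (hV _) (hV _)) (hB k)) (hη k)
  rw [key]
  by_cases hv : v = 0
  · subst hv
    have ha : a ≠ 0 := fun h => hav (by simp [h])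
    obtain ⟨k, hk⟩ := Function.ne_iff.1 ha
    simp only [Pi.zero_apply, zero_div, add_zero, mul_zero, zero_dotProduct]
    exact Finset.sum_pos' (fun j _ => mul_nonneg (hc j).le (sq_nonneg _))
      ⟨k, Finset.mem_univ k, mul_pos (hc k) (sq_pos_of_ne_zero hk)⟩
  · have := hPD.dotProduct_mulVec_pos hv
    rw [star_trivial] at this
    exact add_pos_of_nonneg_of_pos
      (Finset.sum_nonneg fun k _ => mul_nonneg (hc k).le (sq_nonneg _)) this

/-- `W2` has a strict local minimum at an equilibrium with positive definite Hessian. -/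
lemma exists_ball_W2_pos {ep1 ep2 : Fin m → Fin n} (hep : ∀ k, ep1 k ≠ ep2 k)
    {B : Fin m → ℝ} {Bii Xd Xd' Efd : Vec n} {ηb : Vec m} {Vb : Vec n}
    (hEfd : (Emat ep1 ep2 B Bii Xd Xd' ηb).mulVec Vb = Efd)
    (hpos : ∀ (a : Vec m) (v : Vec n), (a, v) ≠ 0 →
      0 < W2Hess ep1 ep2 B Bii Xd Xd' ηb Vb a v) :
    ∃ ε > 0, ∀ p ∈ Metric.ball (ηb, Vb) ε, p ≠ (ηb, Vb) →
      0 < W2 ep1 ep2 B Bii Xd Xd' Efd ηb Vb p.1 p.2 := by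
  obtain ⟨N, S, hN, -, hbN, hS, hNS⟩ := generalized_tube_lemma
    (isCompact_singleton (x := (ηb, Vb))) (isCompact_sphere (0 : Vec m × Vec n) 1)
    (isOpen_lt continuous_const (continuous_W2Hess ep1 ep2 B Bii Xd Xd'))
    (by
      rintro ⟨p, a, v⟩ ⟨hp, hav⟩
      rw [mem_singleton_iff] at hp
      subst hp
      exact hpos a v (ne_zero_of_mem_unit_sphere ⟨(a, v), hav⟩))
  obtain ⟨ε, hε, hball⟩ := Metric.isOpen_iff.1 hN _ (hbN rfl)
  refine ⟨ε, hε, fun p hp hne => ?_⟩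
  have hd : p - (ηb, Vb) ≠ 0 := sub_ne_zero.2 hne
  set d := p - (ηb, Vb) with hd_def
  have hHess : ∀ y ∈ Metric.ball (ηb, Vb) ε,
      0 < W2Hess ep1 ep2 B Bii Xd Xd' y.1 y.2 d.1 d.2 := by
    intro y hy
    have hmem : (y, ‖d‖⁻¹ • d) ∈ N ×ˢ S :=
      ⟨hball hy, hS (by simp [norm_smul, norm_ne_zero_iff.2 hd])⟩
    have h := hNS hmem
    simp only [mem_ofPred_eq, Prod.smul_fst, Prod.smul_snd, W2Hess_smul] at h
    exact pos_of_mul_pos_right h (sq_nonneg _)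
  have hline1 : ∀ s : ℝ, HasDerivAt (fun s : ℝ => ηb + s • d.1) d.1 s := fun s => by
    simpa using ((hasDerivAt_id s).smul_const d.1).const_add ηb
  have hline2 : ∀ s : ℝ, HasDerivAt (fun s : ℝ => Vb + s • d.2) d.2 s := fun s => by
    simpa using ((hasDerivAt_id s).smul_const d.2).const_add Vb
  have hmem : ∀ s ∈ Icc (0 : ℝ) 1, (ηb + s • d.1, Vb + s • d.2) ∈ Metric.ball (ηb, Vb) ε := by
    intro s hs
    have h := (convex_ball (ηb, Vb) ε).add_smul_sub_mem (Metric.mem_ball_self hε) hp hs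
    exact h
  have hW := fun s => hasDerivAt_W2 hep B Bii Xd Xd' Efd ηb Vb (hline1 s) (hline2 s)
  have hG := fun s => hasDerivAt_W2_gradient hep B Bii Xd Xd' Efd
    ((Gam ep1 ep2 B Vb).mulVec (sinv ηb)) (hline1 s) (hline2 s)
  have hGmono := strictMonoOn_of_deriv_pos (convex_Icc (0 : ℝ) 1)
    (fun s _ => (hG s).continuousAt.continuousWithinAt) fun s hs => by
      rw [(hG s).deriv]
      exact hHess _ (hmem s (interior_subset hs))
  have hWmono := strictMonoOn_of_deriv_pos (convex_Icc (0 : ℝ) 1)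
    (fun s _ => (hW s).continuousAt.continuousWithinAt) fun s hs => by
      rw [(hW s).deriv]
      have h := hGmono (left_mem_Icc.2 zero_le_one) (interior_subset hs)
        (by rw [interior_Icc] at hs; exact hs.1)
      simpa [hEfd] using h
  have h := hWmono (left_mem_Icc.2 zero_le_one) (right_mem_Icc.2 zero_le_one) zero_lt_one
  simpa [hd_def, W2] using h

/-- Barbalat's lemma. -/
lemma tendsto_deriv_zero_of_uniformContinuousOn {f f' : ℝ → ℝ} {l : ℝ}
    (hf : ∀ t, HasDerivAt f (f' t) t) (hl : Tendsto f atTop (𝓝 l))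
    (hf' : UniformContinuousOn f' (Ici 0)) : Tendsto f' atTop (𝓝 0) := by
  rw [Metric.tendsto_atTop]
  intro ε hε
  obtain ⟨δ, hδ, hunif⟩ := Metric.uniformContinuousOn_iff.1 hf' (ε / 2) (half_pos hε)
  have hslope : Tendsto (fun t => (f (t + δ) - f t) / δ) atTop (𝓝 0) := by
    simpa using ((hl.comp (tendsto_atTop_add_const_right _ δ tendsto_id)).sub hl).div_const δ
  obtain ⟨T, hT⟩ := Metric.tendsto_atTop.1 hslope (ε / 2) (half_pos hε)
  refine ⟨max T 0, fun t ht => ?_⟩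
  have ht0 : 0 ≤ t := (le_max_right _ _).trans ht
  obtain ⟨c, hc, hc'⟩ := exists_hasDerivAt_eq_slope f f' (lt_add_of_pos_right t hδ)
    (fun s _ => (hf s).continuousAt.continuousWithinAt) fun s _ => hf s
  have h1 := hT t ((le_max_left _ _).trans ht)
  rw [add_sub_cancel_left] at hc'
  rw [← hc'] at h1
  have h2 := hunif t ht0 c (ht0.trans hc.1.le) (by
    rw [Real.dist_eq, abs_sub_comm, abs_of_pos (sub_pos.2 hc.1)]
    linarith [hc.2])
  linarith [dist_triangle (f' t) (f' c) 0]

/-- An integral curve of a continuous vector field that stays in a compact set is uniformly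
continuous. -/
lemma uniformContinuousOn_of_hasDerivAt_of_mem_compact {E : Type*} [NormedAddCommGroup E]
    [NormedSpace ℝ E] {F : E → E} (hF : Continuous F) {x : ℝ → E}
    (hx : ∀ t, HasDerivAt x (F (x t)) t) {K : Set E} (hK : IsCompact K)
    (hxK : ∀ t ≥ 0, x t ∈ K) : UniformContinuousOn x (Ici 0) := by
  obtain ⟨C, hC⟩ := hK.exists_bound_of_continuousOn hF.continuousOn
  exact ((convex_Ici (0 : ℝ)).lipschitzOnWith_of_nnnorm_hasDerivWithin_le (C := C.toNNReal)
    (fun t _ => (hx t).hasDerivWithinAt)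
    (fun t ht => NNReal.coe_le_coe.1
      ((hC _ (hxK t ht)).trans (le_coe_toNNReal C)))).uniformContinuousOn

/-- Barbalat's lemma along a precompact integral curve. -/
lemma tendsto_zero_along_of_mem_compact {E : Type*} [NormedAddCommGroup E]
    [NormedSpace ℝ E] {F : E → E} (hF : Continuous F) {x : ℝ → E}
    (hx : ∀ t, HasDerivAt x (F (x t)) t) {K : Set E} (hK : IsCompact K)
    (hxK : ∀ t ≥ 0, x t ∈ K) {g : ℝ → ℝ} {h : E → ℝ} (hh : Continuous h)
    (hg : ∀ t, HasDerivAt g (h (x t)) t) {l : ℝ} (hl : Tendsto g atTop (𝓝 l)) :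
    Tendsto (fun t => h (x t)) atTop (𝓝 0) :=
  tendsto_deriv_zero_of_uniformContinuousOn hg hl
    ((hK.uniformContinuousOn_of_continuous hh.continuousOn).comp
      (uniformContinuousOn_of_hasDerivAt_of_mem_compact hF hx hK hxK) hxK)

/-- A Lyapunov function with a strict local minimum confines the trajectories that start close to
the minimizer. -/
lemma exists_nhds_forall_mem_closedBall {E : Type*} [NormedAddCommGroup E]
    [ProperSpace E] {W : E → ℝ} (hW : Continuous W) {x₀ : E} {r : ℝ} (hr : 0 < r)
    (hmin : ∀ y ∈ Metric.sphere x₀ r, W x₀ < W y) :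
    ∃ U ∈ 𝓝 x₀, ∀ x : ℝ → E, Continuous x → AntitoneOn (fun t => W (x t)) (Ici 0) →
      x 0 ∈ U → ∀ t ≥ 0, x t ∈ Metric.closedBall x₀ r := by
  obtain ⟨c, hc, hcs⟩ : ∃ c, W x₀ < c ∧ ∀ y ∈ Metric.sphere x₀ r, c ≤ W y := by
    rcases (Metric.sphere x₀ r).eq_empty_or_nonempty with he | hne
    · exact ⟨W x₀ + 1, by linarith, by simp [he]⟩
    · obtain ⟨y, hy, hmin'⟩ := (isCompact_sphere x₀ r).exists_isMinOn hne hW.continuousOn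
      exact ⟨W y, hmin y hy, fun z hz => hmin' hz⟩
  refine ⟨Metric.ball x₀ r ∩ {y | W y < c}, inter_mem (Metric.ball_mem_nhds _ hr)
    ((isOpen_lt hW continuous_const).mem_nhds hc), fun x hx hanti h0 t ht => ?_⟩
  by_contra hout
  rw [Metric.mem_closedBall, not_le] at hout
  have hd : Continuous fun s => dist (x s) x₀ := by fun_prop
  obtain ⟨s, hs, hsr⟩ := intermediate_value_Icc ht hd.continuousOn
    ⟨(Metric.mem_ball.1 h0.1).le, hout.le⟩
  have h1 : W (x s) ≤ W (x 0) := hanti self_mem_Ici hs.1 hs.1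
  have h2 : W (x 0) < c := h0.2
  linarith [hcs (x s) hsr]

/-- A function that is antitone on `[0, ∞)` and bounded below there converges. -/
lemma exists_tendsto_of_antitoneOn_Ici {g : ℝ → ℝ} (hg : AntitoneOn g (Ici 0)) {c : ℝ}
    (hc : ∀ t ≥ 0, c ≤ g t) : ∃ l, Tendsto g atTop (𝓝 l) := by
  have hanti : Antitone fun t => g (max t 0) := fun s t hst =>
    hg (mem_Ici.2 (le_max_right _ _)) (mem_Ici.2 (le_max_right _ _)) (max_le_max_right 0 hst)
  refine ⟨_, (tendsto_atTop_ciInf hanti ⟨c, ?_⟩).congr' ?_⟩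
  · rintro _ ⟨t, rfl⟩
    exact hc _ (le_max_right _ _)
  · filter_upwards [eventually_ge_atTop 0] with t ht
    rw [max_eq_left ht]

lemma tendsto_zero_of_mul_sq_le {ι : Type*} {l : Filter ι} {f g : ι → ℝ} {c : ℝ} (hc : 0 < c)
    (hfg : ∀ t, c * f t ^ 2 ≤ g t) (hg : Tendsto g l (𝓝 0)) : Tendsto f l (𝓝 0) := by
  refine squeeze_zero_norm (a := fun t => √(g t / c)) (fun t => ?_) ?_
  · exact abs_le_sqrt ((le_div_iff₀' hc).2 (hfg t))
  · simpa using (hg.div_const c).sqrt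

lemma lapMatrix_dotProduct_mulVec {V : Type*} [Fintype V] [DecidableEq V] (G : SimpleGraph V)
    [DecidableRel G.Adj] (x : V → ℝ) :
    x ⬝ᵥ (G.lapMatrix ℝ).mulVec x
      = (∑ i, ∑ j, if G.Adj i j then (x i - x j) ^ 2 else 0) / 2 := by
  rw [← G.lapMatrix_toLinearMap₂' (R := ℝ), Matrix.toLinearMap₂'_apply']

lemma const_dotProduct_lapMatrix_mulVec {V : Type*} [Fintype V] [DecidableEq V]
    (G : SimpleGraph V) [DecidableRel G.Adj] (c : ℝ) (x : V → ℝ) :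
    (fun _ => c) ⬝ᵥ (G.lapMatrix ℝ).mulVec x = 0 := by
  have h : (fun _ : V => c) = c • fun _ => 1 := by ext; simp
  rw [Matrix.dotProduct_mulVec, ← Matrix.mulVec_transpose, G.isSymm_lapMatrix (R := ℝ), h,
    Matrix.mulVec_smul, G.lapMatrix_mulVec_const_eq_zero, smul_zero, zero_dotProduct]

/-- On a connected graph, vanishing disagreement forces consensus. -/
lemma tendsto_sub_zero_of_tendsto_lapMatrix {V ι : Type*} [Fintype V] [DecidableEq V]
    {G : SimpleGraph V} [DecidableRel G.Adj] (hG : G.Connected) {x : ι → V → ℝ} {l : Filter ι}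
    (h : Tendsto (fun t => x t ⬝ᵥ (G.lapMatrix ℝ).mulVec (x t)) l (𝓝 0)) (i j : V) :
    Tendsto (fun t => x t i - x t j) l (𝓝 0) := by
  have hadj : ∀ i j, G.Adj i j → Tendsto (fun t => x t i - x t j) l (𝓝 0) := by
    intro i j hij
    have hnn : ∀ t i j, 0 ≤ if G.Adj i j then (x t i - x t j) ^ 2 else 0 := fun t i j => by
      split_ifs <;> positivity
    have hle : ∀ t, (x t i - x t j) ^ 2 ≤ 2 * (x t ⬝ᵥ (G.lapMatrix ℝ).mulVec (x t)) := by
      intro t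
      rw [lapMatrix_dotProduct_mulVec, mul_div_cancel₀ _ two_ne_zero]
      calc (x t i - x t j) ^ 2 = if G.Adj i j then (x t i - x t j) ^ 2 else 0 := by simp [hij]
        _ ≤ ∑ j, if G.Adj i j then (x t i - x t j) ^ 2 else 0 :=
          Finset.single_le_sum (f := fun j => if G.Adj i j then (x t i - x t j) ^ 2 else 0)
            (fun j _ => hnn t i j) (Finset.mem_univ j)
        _ ≤ _ := Finset.single_le_sum
            (f := fun i => ∑ j, if G.Adj i j then (x t i - x t j) ^ 2 else 0)
            (fun i _ => Finset.sum_nonneg fun j _ => hnn t i j) (Finset.mem_univ i)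
    exact tendsto_zero_of_mul_sq_le one_pos (fun t => (one_mul _).trans_le (hle t))
      (by simpa using h.const_mul 2)
  obtain ⟨w⟩ := hG.preconnected i j
  induction w with
  | nil => simp [tendsto_const_nhds]
  | cons hA _ ih => simpa using (hadj _ _ hA).add ih

/-- The closed-loop vector field in the state `(η, ω, V, θ)`. -/
def closedLoop (ep1 ep2 : Fin m → Fin n) (B : Fin m → ℝ) (Bii Xd Xd' Md Ad Td q : Vec n)
    (G : SimpleGraph (Fin n)) [DecidableRel G.Adj] (Efd Pl : Vec n)
    (p : Vec m × Vec n × Vec n × Vec n) : Vec m × Vec n × Vec n × Vec n :=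
  ((incD ep1 ep2)ᵀ.mulVec p.2.1,
    (Matrix.diagonal fun i => (Md i)⁻¹).mulVec
      ((Matrix.diagonal fun i => (q i)⁻¹).mulVec p.2.2.2
        - (incD ep1 ep2).mulVec ((Gam ep1 ep2 B p.2.2.1).mulVec (sinv p.1))
        - (Matrix.diagonal Ad).mulVec p.2.1 - Pl),
    (Matrix.diagonal fun i => (Td i)⁻¹).mulVec
      (-(Emat ep1 ep2 B Bii Xd Xd' p.1).mulVec p.2.2.1 + Efd),
    -(G.lapMatrix ℝ).mulVec p.2.2.2 - (Matrix.diagonal fun i => (q i)⁻¹).mulVec p.2.1)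

/-- The closed-loop storage function: kinetic energy, `W2`, and controller energy relative to the
consensus value `c`. -/
def storage (ep1 ep2 : Fin m → Fin n) (B : Fin m → ℝ) (Bii Xd Xd' Md Efd : Vec n)
    (ηb : Vec m) (Vb : Vec n) (c : ℝ) (p : Vec m × Vec n × Vec n × Vec n) : ℝ :=
  W2 ep1 ep2 B Bii Xd Xd' Efd ηb Vb p.1 p.2.2.1
    + (1 / 2 * ∑ i, Md i * p.2.1 i ^ 2 + 1 / 2 * ∑ i, (p.2.2.2 i - c) ^ 2)

/-- The rate at which `storage` decreases along the closed loop. -/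
def dissipation (ep1 ep2 : Fin m → Fin n) (B : Fin m → ℝ) (Bii Xd Xd' Ad Td : Vec n)
    (G : SimpleGraph (Fin n)) [DecidableRel G.Adj] (Efd : Vec n)
    (p : Vec m × Vec n × Vec n × Vec n) : ℝ :=
  ∑ i, Ad i * p.2.1 i ^ 2
    + ∑ i, (Td i)⁻¹ * ((Emat ep1 ep2 B Bii Xd Xd' p.1).mulVec p.2.2.1 - Efd) i ^ 2
    + p.2.2.2 ⬝ᵥ (G.lapMatrix ℝ).mulVec p.2.2.2

section ClosedLoop

variable {ep1 ep2 : Fin m → Fin n} {B : Fin m → ℝ} {Bii Xd Xd' Md Ad Td q : Vec n}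
  {G : SimpleGraph (Fin n)} [DecidableRel G.Adj] {Efd Pl Vb : Vec n} {ηb : Vec m} {c : ℝ}

lemma continuous_closedLoop :
    Continuous (closedLoop ep1 ep2 B Bii Xd Xd' Md Ad Td q G Efd Pl) := by
  have hE := continuous_Emat ep1 ep2 B Bii Xd Xd'
  have hΓ := continuous_Gam ep1 ep2 B
  have h1 : Continuous fun p : Vec m × Vec n × Vec n × Vec n =>
      (Gam ep1 ep2 B p.2.2.1).mulVec (sinv p.1) :=
    Continuous.matrix_mulVec (by fun_prop) (by fun_prop)
  have h2 : Continuous fun p : Vec m × Vec n × Vec n × Vec n =>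
      (Emat ep1 ep2 B Bii Xd Xd' p.1).mulVec p.2.2.1 :=
    Continuous.matrix_mulVec (by fun_prop) (by fun_prop)
  have hM : ∀ {k l : ℕ} (M : Matrix (Fin k) (Fin l) ℝ), Continuous fun x => M.mulVec x :=
    fun M => continuous_const.matrix_mulVec continuous_id
  unfold closedLoop
  fun_prop

lemma continuous_dissipation :
    Continuous (dissipation ep1 ep2 B Bii Xd Xd' Ad Td G Efd) := by
  have hE := continuous_Emat ep1 ep2 B Bii Xd Xd'
  have h1 : Continuous fun p : Vec m × Vec n × Vec n × Vec n =>
      (Emat ep1 ep2 B Bii Xd Xd' p.1).mulVec p.2.2.1 - Efd :=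
    Continuous.sub (Continuous.matrix_mulVec (by fun_prop) (by fun_prop)) continuous_const
  have h2 : Continuous fun p : Vec m × Vec n × Vec n × Vec n =>
      p.2.2.2 ⬝ᵥ (G.lapMatrix ℝ).mulVec p.2.2.2 :=
    Continuous.dotProduct (by fun_prop) (Continuous.matrix_mulVec (by fun_prop) (by fun_prop))
  unfold dissipation
  fun_prop

lemma continuous_storage :
    Continuous (storage ep1 ep2 B Bii Xd Xd' Md Efd ηb Vb c) := by
  have h : Continuous fun p : Vec m × Vec n × Vec n × Vec n =>
      W2 ep1 ep2 B Bii Xd Xd' Efd ηb Vb p.1 p.2.2.1 :=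
    (continuous_W2 ep1 ep2 B Bii Xd Xd' Efd ηb Vb).comp
      (f := fun p : Vec m × Vec n × Vec n × Vec n => (p.1, p.2.2.1)) (by fun_prop)
  unfold storage
  fun_prop

lemma dissipation_terms_nonneg (hA : ∀ i, 0 < Ad i) (hT : ∀ i, 0 < Td i)
    (p : Vec m × Vec n × Vec n × Vec n) :
    0 ≤ ∑ i, Ad i * p.2.1 i ^ 2 ∧
    0 ≤ ∑ i, (Td i)⁻¹ * ((Emat ep1 ep2 B Bii Xd Xd' p.1).mulVec p.2.2.1 - Efd) i ^ 2 ∧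
    0 ≤ p.2.2.2 ⬝ᵥ (G.lapMatrix ℝ).mulVec p.2.2.2 :=
  ⟨Finset.sum_nonneg fun i _ => mul_nonneg (hA i).le (sq_nonneg _),
    Finset.sum_nonneg fun i _ => mul_nonneg (inv_pos.2 (hT i)).le (sq_nonneg _),
    (G.posSemidef_lapMatrix ℝ).dotProduct_mulVec_nonneg p.2.2.2⟩

lemma dissipation_nonneg (hA : ∀ i, 0 < Ad i) (hT : ∀ i, 0 < Td i)
    (p : Vec m × Vec n × Vec n × Vec n) :
    0 ≤ dissipation ep1 ep2 B Bii Xd Xd' Ad Td G Efd p := by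
  obtain ⟨h1, h2, h3⟩ := dissipation_terms_nonneg (ep1 := ep1) (ep2 := ep2) (B := B)
    (Bii := Bii) (Xd := Xd) (Xd' := Xd') (G := G) (Efd := Efd) hA hT p
  exact add_nonneg (add_nonneg h1 h2) h3

lemma hasDerivAt_storage (hep : ∀ k, ep1 k ≠ ep2 k) (hM : ∀ i, 0 < Md i)
    (hfeas : (fun i => (q i)⁻¹ * c - Pl i)
      = (incD ep1 ep2).mulVec ((Gam ep1 ep2 B Vb).mulVec (sinv ηb)))
    {x : ℝ → Vec m × Vec n × Vec n × Vec n} {t : ℝ}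
    (hx : HasDerivAt x (closedLoop ep1 ep2 B Bii Xd Xd' Md Ad Td q G Efd Pl (x t)) t) :
    HasDerivAt (fun s => storage ep1 ep2 B Bii Xd Xd' Md Efd ηb Vb c (x s))
      (-dissipation ep1 ep2 B Bii Xd Xd' Ad Td G Efd (x t)) t := by
  have hη := hx.fst
  have hω := hasDerivAt_pi.1 hx.snd.fst
  have hV := hx.snd.snd.fst
  have hθ := hasDerivAt_pi.1 hx.snd.snd.snd
  refine ((hasDerivAt_W2 hep B Bii Xd Xd' Efd ηb Vb hη hV).fun_add
    (((HasDerivAt.fun_sum fun i _ => ((hω i).fun_pow 2).const_mul (Md i)).const_mul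
      (1 / 2)).fun_add
    ((HasDerivAt.fun_sum fun i _ => ((hθ i).sub_const c).fun_pow 2).const_mul
      (1 / 2)))).congr_deriv ?_
  have hL := const_dotProduct_lapMatrix_mulVec G c (x t).2.2.2
  set y := (Gam ep1 ep2 B (x t).2.2.1).mulVec (sinv (x t).1) with hy
  set L := (G.lapMatrix ℝ).mulVec (x t).2.2.2 with hL_def
  have hflow : (y - (Gam ep1 ep2 B Vb).mulVec (sinv ηb)) ⬝ᵥ (incD ep1 ep2)ᵀ.mulVec (x t).2.1
      = ∑ i, (((incD ep1 ep2).mulVec y) i - ((q i)⁻¹ * c - Pl i)) * (x t).2.1 i := by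
    rw [Matrix.dotProduct_mulVec, Matrix.vecMul_transpose, Matrix.mulVec_sub, ← hfeas]
    rfl
  simp only [closedLoop, ← hy, ← hL_def, hflow, dissipation]
  have hsum : ∀ i, (((incD ep1 ep2).mulVec y) i - ((q i)⁻¹ * c - Pl i)) * (x t).2.1 i
      + (1 / 2) * (Md i * (2 * (x t).2.1 i * ((Md i)⁻¹ * ((q i)⁻¹ * (x t).2.2.2 i
        - ((incD ep1 ep2).mulVec y) i - Ad i * (x t).2.1 i - Pl i))))
      + (1 / 2) * (2 * ((x t).2.2.2 i - c) * (-L i - (q i)⁻¹ * (x t).2.1 i))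
      = - (Ad i * (x t).2.1 i ^ 2) - (x t).2.2.2 i * L i + c * L i := fun i => by
    have := (hM i).ne'
    field_simp
    ring
  replace hsum := Finset.sum_congr (rfl : (Finset.univ : Finset (Fin n)) = _) fun i _ => hsum i
  simp only [Finset.sum_add_distrib, Finset.sum_sub_distrib, Finset.sum_neg_distrib,
    ← Finset.mul_sum] at hsum
  have hvolt : ∀ R : Vec n, (Matrix.diagonal fun i => (Td i)⁻¹).mulVec (-R) ⬝ᵥ R
      = -∑ i, (Td i)⁻¹ * R i ^ 2 := fun R => by
    rw [← Finset.sum_neg_distrib]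
    exact Finset.sum_congr rfl fun i _ => by rw [Matrix.mulVec_diagonal, Pi.neg_apply]; ring
  rw [neg_add_eq_sub, ← neg_sub, hvolt]
  simp only [dotProduct] at hL ⊢
  simp only [← Finset.mul_sum] at hL
  simp only [Matrix.mulVec_diagonal, Pi.sub_apply, Pi.neg_apply, Nat.cast_ofNat,
    Nat.add_one_sub_one, pow_one] at hsum ⊢
  linarith

/-- The storage function exceeds its equilibrium value on a small sphere around the
equilibrium. -/
lemma exists_forall_mem_sphere_storage_lt (hM : ∀ i, 0 < Md i) {ε : ℝ} (hε : 0 < ε)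
    (hW : ∀ p ∈ Metric.ball (ηb, Vb) ε, p ≠ (ηb, Vb) →
      0 < W2 ep1 ep2 B Bii Xd Xd' Efd ηb Vb p.1 p.2) :
    ∃ r > 0, ∀ p ∈ Metric.sphere
        ((ηb, 0, Vb, fun _ => c) : Vec m × Vec n × Vec n × Vec n) r,
      storage ep1 ep2 B Bii Xd Xd' Md Efd ηb Vb c (ηb, 0, Vb, fun _ => c)
        < storage ep1 ep2 B Bii Xd Xd' Md Efd ηb Vb c p := by
  have hW0 : W2 ep1 ep2 B Bii Xd Xd' Efd ηb Vb ηb Vb = 0 := by simp [W2]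
  refine ⟨ε / 2, half_pos hε, ?_⟩
  rintro ⟨η, ω, V, θ⟩ hp
  have hne : (η, ω, V, θ) ≠ (ηb, 0, Vb, fun _ => c) := Metric.ne_of_mem_sphere hp (half_pos hε).ne'
  have hmem : (η, V) ∈ Metric.ball (ηb, Vb) ε := by
    have h : max (dist η ηb) (max (dist ω 0) (max (dist V Vb) (dist θ fun _ => c))) = ε / 2 := hp
    rw [Metric.mem_ball, Prod.dist_eq]
    refine max_lt ?_ ?_
    · exact ((le_max_left _ _).trans h.le).trans_lt (half_lt_self hε)
    · exact ((((le_max_left _ _).trans (le_max_right _ _)).trans (le_max_right _ _)).trans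
        h.le).trans_lt (half_lt_self hε)
  have hω : ∀ i, 0 ≤ Md i * ω i ^ 2 := fun i => mul_nonneg (hM i).le (sq_nonneg _)
  have hθ : ∀ i, 0 ≤ (θ i - c) ^ 2 := fun i => sq_nonneg _
  have hωs := Finset.sum_nonneg fun i (_ : i ∈ Finset.univ) => hω i
  have hθs := Finset.sum_nonneg fun i (_ : i ∈ Finset.univ) => hθ i
  simp only [storage, hW0, Pi.zero_apply, sub_self]
  simp only [ne_eq, OfNat.ofNat_ne_zero, not_false_eq_true, zero_pow, mul_zero,
    Finset.sum_const_zero, add_zero]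
  by_cases hηV : (η, V) = (ηb, Vb)
  · obtain ⟨rfl, rfl⟩ := Prod.mk.inj hηV
    rw [hW0]
    by_cases hω0 : ω = 0
    · have hθ0 : θ ≠ fun _ => c := fun h => hne (by rw [hω0, h])
      obtain ⟨i, hi⟩ := Function.ne_iff.1 hθ0
      have := Finset.sum_pos' (fun j _ => hθ j)
        ⟨i, Finset.mem_univ i, sq_pos_of_ne_zero (sub_ne_zero.2 hi)⟩
      linarith
    · obtain ⟨i, hi⟩ := Function.ne_iff.1 hω0
      have := Finset.sum_pos' (fun j _ => hω j)
        ⟨i, Finset.mem_univ i, mul_pos (hM i) (sq_pos_of_ne_zero hi)⟩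
      linarith
  · linarith [hW _ hmem hηV]

end ClosedLoop

section Convergence

variable {ep1 ep2 : Fin m → Fin n} {B : Fin m → ℝ} {Bii Xd Xd' Md Ad Td q : Vec n}
  {G : SimpleGraph (Fin n)} [DecidableRel G.Adj] {Efd Pl Vb : Vec n} {ηb : Vec m} {c : ℝ}
  {x : ℝ → Vec m × Vec n × Vec n × Vec n} {K : Set (Vec m × Vec n × Vec n × Vec n)}

lemma antitone_storage (hep : ∀ k, ep1 k ≠ ep2 k)
    (hM : ∀ i, 0 < Md i) (hA : ∀ i, 0 < Ad i) (hT : ∀ i, 0 < Td i)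
    (hfeas : (fun i => (q i)⁻¹ * c - Pl i)
      = (incD ep1 ep2).mulVec ((Gam ep1 ep2 B Vb).mulVec (sinv ηb)))
    (hx : ∀ t, HasDerivAt x (closedLoop ep1 ep2 B Bii Xd Xd' Md Ad Td q G Efd Pl (x t)) t) :
    Antitone fun t => storage ep1 ep2 B Bii Xd Xd' Md Efd ηb Vb c (x t) :=
  antitone_of_hasDerivAt_nonpos (fun t => hasDerivAt_storage hep hM hfeas (hx t))
    fun t => neg_nonpos.2 (dissipation_nonneg hA hT (x t))

lemma tendsto_dissipation (hep : ∀ k, ep1 k ≠ ep2 k)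
    (hM : ∀ i, 0 < Md i) (hA : ∀ i, 0 < Ad i) (hT : ∀ i, 0 < Td i)
    (hfeas : (fun i => (q i)⁻¹ * c - Pl i)
      = (incD ep1 ep2).mulVec ((Gam ep1 ep2 B Vb).mulVec (sinv ηb)))
    (hx : ∀ t, HasDerivAt x (closedLoop ep1 ep2 B Bii Xd Xd' Md Ad Td q G Efd Pl (x t)) t)
    (hK : IsCompact K) (hxK : ∀ t ≥ 0, x t ∈ K) :
    Tendsto (fun t => dissipation ep1 ep2 B Bii Xd Xd' Ad Td G Efd (x t)) atTop (𝓝 0) := by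
  obtain ⟨b, hb⟩ := hK.bddBelow_image
    (continuous_storage (ep1 := ep1) (ep2 := ep2) (B := B) (Bii := Bii) (Xd := Xd) (Xd' := Xd')
      (Md := Md) (Efd := Efd) (ηb := ηb) (Vb := Vb) (c := c)).continuousOn
  obtain ⟨l, hl⟩ := exists_tendsto_of_antitoneOn_Ici
    ((antitone_storage hep hM hA hT hfeas hx).antitoneOn _)
    fun t ht => hb (mem_image_of_mem _ (hxK t ht))
  simpa using (tendsto_zero_along_of_mem_compact continuous_closedLoop hx hK hxK
    continuous_dissipation.neg (fun t => hasDerivAt_storage hep hM hfeas (hx t)) hl).neg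

lemma tendsto_frequency (hA : ∀ i, 0 < Ad i) (hT : ∀ i, 0 < Td i)
    (h : Tendsto (fun t => dissipation ep1 ep2 B Bii Xd Xd' Ad Td G Efd (x t)) atTop (𝓝 0)) :
    Tendsto (fun t => (x t).2.1) atTop (𝓝 0) := by
  refine tendsto_pi_nhds.2 fun i => tendsto_zero_of_mul_sq_le (hA i) (fun t => ?_) h
  obtain ⟨-, h2, h3⟩ := dissipation_terms_nonneg (ep1 := ep1) (ep2 := ep2) (B := B)
    (Bii := Bii) (Xd := Xd) (Xd' := Xd') (G := G) (Efd := Efd) hA hT (x t)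
  have := Finset.single_le_sum (f := fun i => Ad i * (x t).2.1 i ^ 2)
    (fun j _ => mul_nonneg (hA j).le (sq_nonneg _)) (Finset.mem_univ i)
  unfold dissipation
  linarith

lemma tendsto_voltage_residual (hA : ∀ i, 0 < Ad i) (hT : ∀ i, 0 < Td i)
    (h : Tendsto (fun t => dissipation ep1 ep2 B Bii Xd Xd' Ad Td G Efd (x t)) atTop (𝓝 0)) :
    Tendsto (fun t => (Emat ep1 ep2 B Bii Xd Xd' (x t).1).mulVec (x t).2.2.1 - Efd)
      atTop (𝓝 0) := by
  refine tendsto_pi_nhds.2 fun i =>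
    tendsto_zero_of_mul_sq_le (inv_pos.2 (hT i)) (fun t => ?_) h
  obtain ⟨h1, -, h3⟩ := dissipation_terms_nonneg (ep1 := ep1) (ep2 := ep2) (B := B)
    (Bii := Bii) (Xd := Xd) (Xd' := Xd') (G := G) (Efd := Efd) hA hT (x t)
  have := Finset.single_le_sum (f := fun i => (Td i)⁻¹ *
      ((Emat ep1 ep2 B Bii Xd Xd' (x t).1).mulVec (x t).2.2.1 - Efd) i ^ 2)
    (fun j _ => mul_nonneg (inv_pos.2 (hT j)).le (sq_nonneg _)) (Finset.mem_univ i)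
  unfold dissipation
  linarith

lemma tendsto_controller_sub (hG : G.Connected) (hA : ∀ i, 0 < Ad i) (hT : ∀ i, 0 < Td i)
    (h : Tendsto (fun t => dissipation ep1 ep2 B Bii Xd Xd' Ad Td G Efd (x t)) atTop (𝓝 0))
    (i j : Fin n) : Tendsto (fun t => (x t).2.2.2 i - (x t).2.2.2 j) atTop (𝓝 0) := by
  refine tendsto_sub_zero_of_tendsto_lapMatrix hG
    (squeeze_zero (fun t => (dissipation_terms_nonneg (ep1 := ep1) (ep2 := ep2) (B := B)
      (Bii := Bii) (Xd := Xd) (Xd' := Xd') (Efd := Efd) hA hT (x t)).2.2) (fun t => ?_) h) i j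
  obtain ⟨h1, h2, -⟩ := dissipation_terms_nonneg (ep1 := ep1) (ep2 := ep2) (B := B)
    (Bii := Bii) (Xd := Xd) (Xd' := Xd') (G := G) (Efd := Efd) hA hT (x t)
  unfold dissipation
  linarith

/-- Total generation converges to total demand: Barbalat's lemma for the total momentum. -/
lemma tendsto_total_generation (hep : ∀ k, ep1 k ≠ ep2 k) (hM : ∀ i, 0 < Md i)
    (hx : ∀ t, HasDerivAt x (closedLoop ep1 ep2 B Bii Xd Xd' Md Ad Td q G Efd Pl (x t)) t)
    (hK : IsCompact K) (hxK : ∀ t ≥ 0, x t ∈ K)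
    (hω : Tendsto (fun t => (x t).2.1) atTop (𝓝 0)) :
    Tendsto (fun t => ∑ i, (q i)⁻¹ * (x t).2.2.2 i) atTop (𝓝 (∑ i, Pl i)) := by
  have hωi := tendsto_pi_nhds.1 hω
  have hg : ∀ t, HasDerivAt (fun s => ∑ i, Md i * (x s).2.1 i)
      (∑ i, (q i)⁻¹ * (x t).2.2.2 i - ∑ i, Ad i * (x t).2.1 i - ∑ i, Pl i) t := by
    intro t
    have hd := hasDerivAt_pi.1 (hx t).snd.fst
    refine (HasDerivAt.fun_sum fun i _ => (hd i).const_mul (Md i)).congr_deriv ?_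
    have h0 := sum_incD_mulVec hep ((Gam ep1 ep2 B (x t).2.2.1).mulVec (sinv (x t).1))
    have : ∀ i, Md i * (closedLoop ep1 ep2 B Bii Xd Xd' Md Ad Td q G Efd Pl (x t)).2.1 i
        = (q i)⁻¹ * (x t).2.2.2 i
          - ((incD ep1 ep2).mulVec ((Gam ep1 ep2 B (x t).2.2.1).mulVec (sinv (x t).1))) i
          - Ad i * (x t).2.1 i - Pl i := fun i => by
      simp only [closedLoop, Matrix.mulVec_diagonal, Pi.sub_apply]
      rw [mul_inv_cancel_left₀ (hM i).ne']
    simp only [this, Finset.sum_sub_distrib, h0, sub_zero]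
  have hgl : Tendsto (fun s => ∑ i, Md i * (x s).2.1 i) atTop (𝓝 0) := by
    simpa using tendsto_finsetSum Finset.univ fun i _ => (hωi i).const_mul (Md i)
  have hAl : Tendsto (fun s => ∑ i, Ad i * (x s).2.1 i) atTop (𝓝 0) := by
    simpa using tendsto_finsetSum Finset.univ fun i _ => (hωi i).const_mul (Ad i)
  have h := tendsto_zero_along_of_mem_compact continuous_closedLoop hx hK hxK
    (h := fun p => ∑ i, (q i)⁻¹ * p.2.2.2 i - ∑ i, Ad i * p.2.1 i - ∑ i, Pl i)
    (by fun_prop) hg hgl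
  have h' := (h.add hAl).add_const (∑ i, Pl i)
  simp only [add_zero, zero_add] at h'
  exact h'.congr fun t => by ring

lemma tendsto_of_tendsto_sub_of_tendsto_sum {ι κ : Type*} [Fintype κ] {l : Filter ι}
    {w : κ → ℝ} (hw : ∑ j, w j ≠ 0) {θ : ι → κ → ℝ} {S : ℝ}
    (hsub : ∀ i j, Tendsto (fun t => θ t i - θ t j) l (𝓝 0))
    (hsum : Tendsto (fun t => ∑ j, w j * θ t j) l (𝓝 S)) :
    Tendsto θ l (𝓝 fun _ => S / ∑ j, w j) := by
  refine tendsto_pi_nhds.2 fun i => ?_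
  have h := (hsum.add (tendsto_finsetSum Finset.univ fun j _ =>
    (hsub i j).const_mul (w j))).div_const (∑ j, w j)
  simp only [mul_zero, Finset.sum_const_zero, add_zero] at h
  refine h.congr fun t => ?_
  rw [← Finset.sum_add_distrib, div_eq_iff hw, Finset.mul_sum]
  exact Finset.sum_congr rfl fun j _ => by ring

lemma closedLoop_tendsto (hep : ∀ k, ep1 k ≠ ep2 k)
    (hM : ∀ i, 0 < Md i) (hA : ∀ i, 0 < Ad i) (hT : ∀ i, 0 < Td i) (hq : ∑ j, (q j)⁻¹ ≠ 0)
    (hG : G.Connected)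
    (hfeas : (fun i => (q i)⁻¹ * c - Pl i)
      = (incD ep1 ep2).mulVec ((Gam ep1 ep2 B Vb).mulVec (sinv ηb)))
    (hx : ∀ t, HasDerivAt x (closedLoop ep1 ep2 B Bii Xd Xd' Md Ad Td q G Efd Pl (x t)) t)
    (hK : IsCompact K) (hxK : ∀ t ≥ 0, x t ∈ K) :
    Tendsto (fun t => (x t).2.1) atTop (𝓝 0) ∧
      Tendsto (fun t => (x t).2.2.2) atTop (𝓝 fun _ => (∑ j, Pl j) / ∑ j, (q j)⁻¹) ∧
      Tendsto (fun t => (Emat ep1 ep2 B Bii Xd Xd' (x t).1).mulVec (x t).2.2.1 - Efd)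
        atTop (𝓝 0) := by
  have hdiss := tendsto_dissipation hep hM hA hT hfeas hx hK hxK
  have hω := tendsto_frequency hA hT hdiss
  exact ⟨hω, tendsto_of_tendsto_sub_of_tendsto_sum (θ := fun t => (x t).2.2.2) hq
    (tendsto_controller_sub hG hA hT hdiss)
    (tendsto_total_generation hep hM hx hK hxK hω), tendsto_voltage_residual hA hT hdiss⟩

end Convergence

/-- Allocating a total demand in proportion to the inverse costs is feasible and minimizes the
quadratic cost. -/
lemma optimal_allocation {q Pl : Vec n} (hq : ∀ i, 0 < q i) (hsum : ∑ j, (q j)⁻¹ ≠ 0) :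
    (∑ i, ((q i)⁻¹ * ((∑ j, Pl j) / (∑ j, (q j)⁻¹)) - Pl i) = 0) ∧
      ∀ u : Vec n, ∑ i, (u i - Pl i) = 0 →
        (1 / 2) * ((fun i => (q i)⁻¹ * ((∑ j, Pl j) / (∑ j, (q j)⁻¹)))
            ⬝ᵥ (Matrix.diagonal q).mulVec
              (fun i => (q i)⁻¹ * ((∑ j, Pl j) / (∑ j, (q j)⁻¹))))
          ≤ (1 / 2) * (u ⬝ᵥ (Matrix.diagonal q).mulVec u) := by
  set c := (∑ j, Pl j) / (∑ j, (q j)⁻¹) with hc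
  have hfeas : ∑ i, ((q i)⁻¹ * c - Pl i) = 0 := by
    rw [Finset.sum_sub_distrib, ← Finset.sum_mul, hc, mul_div_cancel₀ _ hsum, sub_self]
  refine ⟨hfeas, fun u hu => ?_⟩
  gcongr
  have h : ∀ i, (q i)⁻¹ * c * (q i * ((q i)⁻¹ * c))
      + 2 * c * ((u i - Pl i) - ((q i)⁻¹ * c - Pl i)) ≤ u i * (q i * u i) := fun i => by
    have hsq := mul_nonneg (hq i).le (sq_nonneg (u i - (q i)⁻¹ * c))
    have hqi : q i * (q i)⁻¹ = 1 := mul_inv_cancel₀ (hq i).ne'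
    linear_combination hsq - 2 * c * (u i - (q i)⁻¹ * c) * hqi
  have := Finset.sum_le_sum fun i (_ : i ∈ Finset.univ) => h i
  rw [Finset.sum_add_distrib, ← Finset.mul_sum, Finset.sum_sub_distrib, hu, hfeas] at this
  simpa [dotProduct, Matrix.mulVec_diagonal] using this


lemma exists_forall_sum_norm_le {E₁ E₂ E₃ E₄ : Type*} [SeminormedAddCommGroup E₁]
    [SeminormedAddCommGroup E₂] [SeminormedAddCommGroup E₃] [SeminormedAddCommGroup E₄]
    {K : Set (E₁ × E₂ × E₃ × E₄)} (hK : IsCompact K) :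
    ∃ C : ℝ, ∀ p ∈ K, ‖p.1‖ + ‖p.2.1‖ + ‖p.2.2.1‖ + ‖p.2.2.2‖ ≤ C := by
  obtain ⟨C, hC⟩ := hK.bddAbove_image
    (f := fun p : E₁ × E₂ × E₃ × E₄ => ‖p.1‖ + ‖p.2.1‖ + ‖p.2.2.1‖ + ‖p.2.2.2‖)
    (Continuous.continuousOn (by fun_prop))
  exact ⟨C, fun p hp => hC (mem_image_of_mem _ hp)⟩

/-- Theorem 2: with the distributed controller `θ̇ = −L_comm θ − Q⁻¹ω`,
`u = Q⁻¹θ`, solutions starting near `(η̄, 0, V̄, θ̄)` are bounded, the frequency deviation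
converges to zero, `θ → θ̄`, `u → ū = Q⁻¹θ̄`, `E(η)V − Ē_fd → 0`, and `ū` minimizes the
generation cost subject to the power balance. -/
theorem optimal_frequency_regulation_constant_demand
    {n m : ℕ} (ep1 ep2 : Fin m → Fin n) (hep : ∀ k, ep1 k ≠ ep2 k)
    (B : Fin m → ℝ) (hB : ∀ k, 0 < B k)
    (Bii Xd Xd' : Vec n)
    (Md Ad Td : Vec n) (hM : ∀ i, 0 < Md i) (hA : ∀ i, 0 < Ad i) (hT : ∀ i, 0 < Td i)
    (q : Vec n) (hq : ∀ i, 0 < q i)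
    (G : SimpleGraph (Fin n)) [DecidableRel G.Adj] (hG : G.Connected)
    (Efd Pl : Vec n)
    (ηb : Vec m) (hηbr : ∃ δ : Vec n, ηb = (incD ep1 ep2)ᵀ.mulVec δ)
    (Vb : Vec n) (hVb : ∀ i, 0 < Vb i)
    -- Assumption 4: `(Q⁻¹11ᵀ/(1ᵀQ⁻¹1) − I)Pˡ = DΓ(V̄)sin(η̄)` and `E(η̄)V̄ = Ē_fd`
    (hfeas : (fun i => (q i)⁻¹ * ((∑ j, Pl j) / (∑ j, (q j)⁻¹)) - Pl i)
      = (incD ep1 ep2).mulVec ((Gam ep1 ep2 B Vb).mulVec (sinv ηb)))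
    (hEfd : (Emat ep1 ep2 B Bii Xd Xd' ηb).mulVec Vb = Efd)
    -- Assumption 3
    (hsec : ∀ k, ηb k ∈ Set.Ioo (-(π / 2)) (π / 2))
    (hPD : (Schur ep1 ep2 B Bii Xd Xd' ηb Vb).PosDef) :
    ∃ U ∈ 𝓝 ((ηb, 0, Vb, fun _ => (∑ j, Pl j) / (∑ j, (q j)⁻¹)) :
        Vec m × Vec n × Vec n × Vec n),
      (∀ (η : ℝ → Vec m) (ω ω' V V' θ : ℝ → Vec n),
        (∀ t, HasDerivAt η ((incD ep1 ep2)ᵀ.mulVec (ω t)) t) →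
        (∀ t, HasDerivAt ω (ω' t) t) →
        (∀ t, (Matrix.diagonal Md).mulVec (ω' t)
          = (Matrix.diagonal fun i => (q i)⁻¹).mulVec (θ t)
            - (incD ep1 ep2).mulVec ((Gam ep1 ep2 B (V t)).mulVec (sinv (η t)))
            - (Matrix.diagonal Ad).mulVec (ω t) - Pl) →
        (∀ t, HasDerivAt V (V' t) t) →
        (∀ t, (Matrix.diagonal Td).mulVec (V' t)
          = -(Emat ep1 ep2 B Bii Xd Xd' (η t)).mulVec (V t) + Efd) →
        (∀ t, HasDerivAt θ
          (-(G.lapMatrix ℝ).mulVec (θ t)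
            - (Matrix.diagonal fun i => (q i)⁻¹).mulVec (ω t)) t) →
        (η 0, ω 0, V 0, θ 0) ∈ U →
        (∃ C : ℝ, ∀ t ≥ (0:ℝ), ‖η t‖ + ‖ω t‖ + ‖V t‖ + ‖θ t‖ ≤ C) ∧
        Filter.Tendsto ω Filter.atTop (𝓝 0) ∧
        Filter.Tendsto θ Filter.atTop (𝓝 (fun _ => (∑ j, Pl j) / (∑ j, (q j)⁻¹))) ∧
        Filter.Tendsto (fun t => (Matrix.diagonal fun i => (q i)⁻¹).mulVec (θ t))
          Filter.atTop (𝓝 (fun i => (q i)⁻¹ * ((∑ j, Pl j) / (∑ j, (q j)⁻¹)))) ∧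
        Filter.Tendsto (fun t => (Emat ep1 ep2 B Bii Xd Xd' (η t)).mulVec (V t) - Efd)
          Filter.atTop (𝓝 0)) ∧
      -- `ū = Q⁻¹θ̄` minimizes `C(u) = ½uᵀQu` subject to `1ᵀ(u − Pˡ) = 0`
      ((∑ i, ((q i)⁻¹ * ((∑ j, Pl j) / (∑ j, (q j)⁻¹)) - Pl i) = 0) ∧
        ∀ u : Vec n, ∑ i, (u i - Pl i) = 0 →
          (1 / 2) * ((fun i => (q i)⁻¹ * ((∑ j, Pl j) / (∑ j, (q j)⁻¹)))
              ⬝ᵥ (Matrix.diagonal q).mulVec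
                (fun i => (q i)⁻¹ * ((∑ j, Pl j) / (∑ j, (q j)⁻¹))))
            ≤ (1 / 2) * (u ⬝ᵥ (Matrix.diagonal q).mulVec u)) := by
  have : Nonempty (Fin n) := hG.nonempty
  have hqsum : ∑ j, (q j)⁻¹ ≠ 0 :=
    (Finset.sum_pos (fun j _ => inv_pos.2 (hq j)) Finset.univ_nonempty).ne'
  have hopt := optimal_allocation (Pl := Pl) hq hqsum
  generalize hc : (∑ j, Pl j) / (∑ j, (q j)⁻¹) = c at hfeas hopt ⊢
  obtain ⟨ε, hε, hW⟩ := exists_ball_W2_pos hep hEfd fun a v hav =>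
    W2Hess_pos hep hB hVb (fun k => cos_pos_of_mem_Ioo (hsec k)) hPD hav
  obtain ⟨r, hr, hsphere⟩ := exists_forall_mem_sphere_storage_lt (c := c) hM hε hW
  obtain ⟨U, hU, hconf⟩ := exists_nhds_forall_mem_closedBall continuous_storage hr hsphere
  refine ⟨U, hU, fun η ω ω' V V' θ hη hω hω' hV hV' hθ h0 => ?_, hopt⟩
  have hx : ∀ t, HasDerivAt (fun t => (η t, ω t, V t, θ t))
      (closedLoop ep1 ep2 B Bii Xd Xd' Md Ad Td q G Efd Pl (η t, ω t, V t, θ t)) t := by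
    intro t
    refine (hη t).prodMk ((hω t).congr_deriv ?_ |>.prodMk
      ((hV t).congr_deriv ?_ |>.prodMk (hθ t)))
    · simp only [← hω' t]
      ext i
      simp [Matrix.mulVec_diagonal, (hM i).ne']
    · simp only [← hV' t]
      ext i
      simp [Matrix.mulVec_diagonal, (hT i).ne']
  have hcont : Continuous fun t => (η t, ω t, V t, θ t) :=
    continuous_iff_continuousAt.2 fun t => (hx t).continuousAt
  have hxK := hconf _ hcont ((antitone_storage hep hM hA hT hfeas hx).antitoneOn _) h0
  have hK := isCompact_closedBall (ηb, (0 : Vec n), Vb, fun _ : Fin n => c) r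
  obtain ⟨hω0, hθc, hres⟩ := closedLoop_tendsto hep hM hA hT hqsum hG hfeas hx hK hxK
  rw [hc] at hθc
  refine ⟨?_, hω0, hθc, ?_, hres⟩
  · obtain ⟨C, hC⟩ := exists_forall_sum_norm_le hK
    exact ⟨C, fun t ht => hC _ (hxK t ht)⟩
  · refine tendsto_pi_nhds.2 fun i => ?_
    simp only [Matrix.mulVec_diagonal]
    exact (tendsto_pi_nhds.1 hθc i).const_mul _
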